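/- There exists a constant C > 0, independent of α, L and A, such that for every x = (x₁,x₂,a) ∈ G with 0 < a < e^{−1−3α/2} and |x| > 2L, the integral ∫_G A(y) k₁(y⁻¹x) dλ(y) converges absolutely and | ∫_G A(y) k₁(y⁻¹x) dλ(y) | ≤ C a / |x|³. -/

import Mathlib

open Real MeasureTheory Set

noncomputable section

/-- `cosh` of the hyperbolic distance from `p = (x₁, x₂, a)` to the identity `e = (0,0,1)`. -/
def chD (p : ℝ × ℝ × ℝ) : ℝ :=
  (p.2.2 + (p.2.2)⁻¹ + (p.2.2)⁻¹ * (p.1 ^ 2 + p.2.1 ^ 2)) / 2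

/-- The hyperbolic distance `r(p)` from `p` to the identity, i.e. `arcosh (chD p)`. -/
def rD (p : ℝ × ℝ × ℝ) : ℝ := Real.log (chD p + Real.sqrt (chD p ^ 2 - 1))

/-- `|x| = √(x₁² + x₂²)`. -/
def nm (p : ℝ × ℝ × ℝ) : ℝ := Real.sqrt (p.1 ^ 2 + p.2.1 ^ 2)

/-- The kernel `k₁`. -/
def k1 (p : ℝ × ℝ × ℝ) : ℝ :=
  -(2 * Real.pi ^ 2)⁻¹ * (p.2.2)⁻¹ * p.1 *
    (Real.sinh (rD p) + rD p * Real.cosh (rD p)) / (rD p ^ 2 * Real.sinh (rD p) ^ 3)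

/-- The kernel `k₂`. -/
def k2 (p : ℝ × ℝ × ℝ) : ℝ :=
  -(2 * Real.pi ^ 2)⁻¹ * (p.2.2)⁻¹ * p.2.1 *
    (Real.sinh (rD p) + rD p * Real.cosh (rD p)) / (rD p ^ 2 * Real.sinh (rD p) ^ 3)

/-- The kernel `k₀`. -/
def k0 (p : ℝ × ℝ × ℝ) : ℝ :=
  (2 * Real.pi ^ 2)⁻¹ *
    (-(Real.sinh (rD p) + rD p * Real.cosh (rD p)) +
      (p.2.2)⁻¹ * (Real.cosh (rD p) * Real.sinh (rD p) + rD p)) /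
    (rD p ^ 2 * Real.sinh (rD p) ^ 3)

/-- `y⁻¹ · x` in the group `G = ℝ² ⋊ ℝ⁺`. -/
def ginvMul (y x : ℝ × ℝ × ℝ) : ℝ × ℝ × ℝ :=
  ((y.2.2)⁻¹ * (x.1 - y.1), (y.2.2)⁻¹ * (x.2.1 - y.2.1), x.2.2 / y.2.2)

/-- The right Haar measure `ρ`, of density `a⁻¹` w.r.t. Lebesgue measure on `{a > 0}`. -/
def ρG : Measure (ℝ × ℝ × ℝ) :=
  (volume.restrict {p : ℝ × ℝ × ℝ | 0 < p.2.2}).withDensity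
    (fun p => ENNReal.ofReal (p.2.2)⁻¹)

/-- The left Haar measure `λ`, of density `a⁻³` w.r.t. Lebesgue measure on `{a > 0}`. -/
def lG : Measure (ℝ × ℝ × ℝ) :=
  (volume.restrict {p : ℝ × ℝ × ℝ | 0 < p.2.2}).withDensity
    (fun p => ENNReal.ofReal ((p.2.2) ^ 3)⁻¹)

/-- The set `P₀ = [−1,1] × [−1,1] × [e⁻¹, e]`. -/
def P0 : Set (ℝ × ℝ × ℝ) :=
  {p | p.1 ∈ Icc (-1 : ℝ) 1 ∧ p.2.1 ∈ Icc (-1 : ℝ) 1 ∧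
       p.2.2 ∈ Icc (Real.exp (-1)) (Real.exp 1)}

/-- The set `2P₀ = [−2,2] × [−2,2] × [e⁻², e²]`. -/
def twoP0 : Set (ℝ × ℝ × ℝ) :=
  {p | p.1 ∈ Icc (-2 : ℝ) 2 ∧ p.2.1 ∈ Icc (-2 : ℝ) 2 ∧
       p.2.2 ∈ Icc (Real.exp (-2)) (Real.exp 2)}

/-- The set `P_L = [L−1,L+1] × [−1,1] × [e⁻¹, e]`. -/
def PL (L : ℝ) : Set (ℝ × ℝ × ℝ) :=
  {p | p.1 ∈ Icc (L - 1) (L + 1) ∧ p.2.1 ∈ Icc (-1 : ℝ) 1 ∧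
       p.2.2 ∈ Icc (Real.exp (-1)) (Real.exp 1)}

/-- The set `2P_L = [L−2,L+2] × [−2,2] × [e⁻², e²]`. -/
def twoPL (L : ℝ) : Set (ℝ × ℝ × ℝ) :=
  {p | p.1 ∈ Icc (L - 2) (L + 2) ∧ p.2.1 ∈ Icc (-2 : ℝ) 2 ∧
       p.2.2 ∈ Icc (Real.exp (-2)) (Real.exp 2)}

/-- The Calderón–Zygmund set `R = [−L/2,L/2]² × [e^{−α}, e^{α}]`. -/
def Rset (α L : ℝ) : Set (ℝ × ℝ × ℝ) :=
  {p | p.1 ∈ Icc (-L / 2) (L / 2) ∧ p.2.1 ∈ Icc (-L / 2) (L / 2) ∧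
       p.2.2 ∈ Icc (Real.exp (-α)) (Real.exp α)}

lemma cosh_rD (p : ℝ × ℝ × ℝ) (h : 3 ≤ chD p) : Real.cosh (rD p) = chD p := by
  have hs : Real.sqrt (chD p ^ 2 - 1) ^ 2 = chD p ^ 2 - 1 := Real.sq_sqrt (by nlinarith)
  have h0 := Real.sqrt_nonneg (chD p ^ 2 - 1)
  unfold rD
  rw [Real.cosh_log (by linarith)]
  have : chD p + Real.sqrt (chD p ^ 2 - 1) ≠ 0 := by linarith
  field_simp
  nlinarith

lemma one_le_rD (p : ℝ × ℝ × ℝ) (h : 3 ≤ chD p) : 1 ≤ rD p := by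
  have h0 := Real.sqrt_nonneg (chD p ^ 2 - 1)
  unfold rD
  rw [Real.le_log_iff_exp_le (by linarith)]
  have := Real.exp_one_lt_d9
  linarith

lemma factor_bound (p : ℝ × ℝ × ℝ) (h : 3 ≤ chD p) :
    0 ≤ (Real.sinh (rD p) + rD p * Real.cosh (rD p)) / (rD p ^ 2 * Real.sinh (rD p) ^ 3) ∧
    (Real.sinh (rD p) + rD p * Real.cosh (rD p)) / (rD p ^ 2 * Real.sinh (rD p) ^ 3)
      ≤ 16 / chD p ^ 2 := by
  have hr := one_le_rD p h
  have hc := cosh_rD p h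
  have hsq := Real.cosh_sq (rD p)
  have hs0 : 0 < Real.sinh (rD p) := Real.sinh_pos_iff.2 (by linarith)
  have hlt := Real.sinh_lt_cosh (rD p)
  rw [hc] at *
  set s := Real.sinh (rD p)
  set r := rD p
  set c := chD p
  have hsc : c / 2 ≤ s := by nlinarith
  have hc0 : 0 < c := by linarith
  have hr0 : 0 < r := by linarith
  refine ⟨by positivity, ?_⟩
  have h3 : (c / 2) ^ 3 ≤ s ^ 3 := by gcongr
  rw [div_le_div_iff₀ (by positivity) (by positivity)]
  calc (s + r * c) * c ^ 2 ≤ (r * c + r * c) * c ^ 2 := by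
        gcongr; nlinarith
    _ = 16 * (r * (c / 2) ^ 3) := by ring
    _ ≤ 16 * (r ^ 2 * (c / 2) ^ 3) := by gcongr; nlinarith
    _ ≤ 16 * (r ^ 2 * s ^ 3) := by gcongr

lemma k1_bound (p : ℝ × ℝ × ℝ) (h : 3 ≤ chD p) (hp : 0 < p.2.2) :
    |k1 p| ≤ (p.2.2)⁻¹ * |p.1| * (16 / chD p ^ 2) := by
  obtain ⟨h0, h1⟩ := factor_bound p h
  unfold k1
  rw [mul_div_assoc, abs_mul, abs_of_nonneg h0, abs_mul, abs_mul, abs_neg, abs_of_pos (inv_pos.2 hp)]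
  have hpi : |(2 * Real.pi ^ 2)⁻¹| ≤ 1 := by
    rw [abs_of_pos (by positivity)]
    apply inv_le_one_of_one_le₀
    nlinarith [Real.pi_gt_three]
  have hi : 0 < (p.2.2)⁻¹ := inv_pos.2 hp
  calc _ ≤ 1 * (p.2.2)⁻¹ * |p.1| * (16 / chD p ^ 2) := by gcongr
    _ = _ := by ring

lemma kernel_bound (α L : ℝ) (hα : 20 ≤ α) (hL : Real.exp (2 * α) ≤ L)
    (x y : ℝ × ℝ × ℝ) (hx : 0 < x.2.2) (hx' : x.2.2 < Real.exp (-1 - 3 * α / 2))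
    (hN : 2 * L < nm x) (hy : y ∈ Rset α L) :
    |k1 (ginvMul y x)| ≤ 2048 * x.2.2 / nm x ^ 3 * y.2.2 ^ 2 := by
  obtain ⟨x1, x2, a⟩ := x
  obtain ⟨y1, y2, b⟩ := y
  obtain ⟨⟨hy1, hy1'⟩, ⟨hy2, hy2'⟩, hb, hb'⟩ := hy
  have hNsq : nm (x1, x2, a) ^ 2 = x1 ^ 2 + x2 ^ 2 := Real.sq_sqrt (by positivity)
  set N := nm (x1, x2, a)
  simp only at *
  have hb0 : 0 < b := (Real.exp_pos _).trans_le hb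
  have hL1 : 41 ≤ L := by linarith [Real.add_one_le_exp (2 * α)]
  have hab : a * b ≤ 1 := by
    calc a * b ≤ Real.exp (-1 - 3 * α / 2) * Real.exp α := by gcongr
      _ = Real.exp (-1 - α / 2) := by rw [← Real.exp_add]; ring_nf
      _ ≤ 1 := Real.exp_le_one_iff.2 (by linarith)
  have hab0 : 0 < a * b := by positivity
  have hN0 : 0 < N := by linarith
  have hx1 : |x1| ≤ N := abs_le_of_sq_le_sq (by nlinarith [sq_nonneg x2]) hN0.le
  have hx2 : |x2| ≤ N := abs_le_of_sq_le_sq (by nlinarith [sq_nonneg x1]) hN0.le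
  have hd : N ^ 2 / 4 ≤ (x1 - y1) ^ 2 + (x2 - y2) ^ 2 := by
    have hys : y1 ^ 2 + y2 ^ 2 ≤ N ^ 2 / 8 := by nlinarith
    have hs := Real.sq_sqrt (show (0:ℝ) ≤ 2 by norm_num)
    -- |x-y|^2 ≥ (1-t)|x|^2 - (1/t - 1)|y|^2 with t = 3/8
    nlinarith [sq_nonneg (3 * x1 - 8 * y1), sq_nonneg (3 * x2 - 8 * y2)]
  have hch : chD (ginvMul (y1, y2, b) (x1, x2, a)) =
      (a ^ 2 + b ^ 2 + ((x1 - y1) ^ 2 + (x2 - y2) ^ 2)) / (2 * (a * b)) := by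
    simp only [chD, ginvMul]
    field_simp
  have hcl : N ^ 2 / (8 * (a * b)) ≤ chD (ginvMul (y1, y2, b) (x1, x2, a)) := by
    rw [hch, div_le_div_iff₀ (by positivity) (by positivity)]
    nlinarith [sq_nonneg a, sq_nonneg b]
  have h3 : 3 ≤ N ^ 2 / (8 * (a * b)) := by
    rw [le_div_iff₀ (by positivity)]
    nlinarith
  refine (k1_bound _ (h3.trans hcl) (by simp only [ginvMul]; positivity)).trans ?_
  have h16 : 16 / chD (ginvMul (y1, y2, b) (x1, x2, a)) ^ 2 ≤ 16 / (N ^ 2 / (8 * (a * b))) ^ 2 := by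
    gcongr
  have hxy : |x1 - y1| ≤ 2 * N := by
    rw [abs_le] at *
    constructor <;> linarith
  simp only [ginvMul] at h16 ⊢
  rw [abs_mul, abs_of_pos (inv_pos.2 hb0)]
  calc _ ≤ (a / b)⁻¹ * (b⁻¹ * (2 * N)) * (16 / (N ^ 2 / (8 * (a * b))) ^ 2) := by gcongr
    _ = _ := by field_simp; norm_num

lemma lint_inv (α : ℝ) (hα : 20 ≤ α) :
    ∫⁻ b, (Icc (Real.exp (-α)) (Real.exp α)).indicator (fun b => ENNReal.ofReal b⁻¹) b
      = ENNReal.ofReal (2 * α) := by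
  have h0 := Real.exp_pos (-α)
  have hle : Real.exp (-α) ≤ Real.exp α := Real.exp_le_exp.2 (by linarith)
  rw [lintegral_indicator measurableSet_Icc, ← ofReal_integral_eq_lintegral_ofReal]
  · rw [integral_Icc_eq_integral_Ioc, ← intervalIntegral.integral_of_le hle,
      integral_inv_of_pos h0 (Real.exp_pos _), ← Real.exp_sub, Real.log_exp]
    ring_nf
  · apply ContinuousOn.integrableOn_Icc
    exact continuousOn_inv₀.mono fun b hb => (h0.trans_le hb.1).ne'
  · filter_upwards [ae_restrict_mem measurableSet_Icc] with b hb
    exact (inv_pos.2 (h0.trans_le hb.1)).le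

lemma meas_k1 (x : ℝ × ℝ × ℝ) : Measurable fun y => k1 (ginvMul y x) := by
  unfold k1 rD chD ginvMul
  fun_prop

/-- for a large atom `A` and `x ∈ Ω₁` with `|x| > 2L`,
`|R₁A(x)| ≲ a/|x|³`. -/
theorem stmt18 :
    ∃ C : ℝ, 0 < C ∧
      ∀ α L : ℝ, 20 ≤ α → Real.exp (2 * α) ≤ L → L < Real.exp (8 * α) →
      ∀ A : ℝ × ℝ × ℝ → ℂ, Measurable A →
        (∀ y, y ∉ Rset α L → A y = 0) →
        (∀ y, ‖A y‖ ≤ (2 * α * L ^ 2)⁻¹) →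
      ∀ x : ℝ × ℝ × ℝ, 0 < x.2.2 → x.2.2 < Real.exp (-1 - 3 * α / 2) →
        2 * L < nm x →
        Integrable (fun y => A y * (k1 (ginvMul y x) : ℂ)) lG ∧
        ‖∫ y, A y * (k1 (ginvMul y x) : ℂ) ∂lG‖ ≤ C * x.2.2 / nm x ^ 3 := by
  refine ⟨2048, by norm_num, ?_⟩
  intro α L hα hL _ A hA hsupp hbd x hx hx' hN
  have hL0 : 0 < L := (Real.exp_pos _).trans_le hL
  have hN0 : 0 < nm x := by linarith
  have hα0 : 0 < α := by linarith
  set K : ℝ := 2048 * x.2.2 / nm x ^ 3 with hK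
  have hK0 : 0 ≤ K := by positivity
  have hmeas : Measurable fun y => A y * (k1 (ginvMul y x) : ℂ) :=
    hA.mul (Complex.measurable_ofReal.comp (meas_k1 x))
  have key : ∫⁻ y, ‖A y * (k1 (ginvMul y x) : ℂ)‖ₑ ∂lG ≤ ENNReal.ofReal K := by
    unfold lG
    rw [lintegral_withDensity_eq_lintegral_mul _ (by fun_prop) hmeas.enorm]
    refine (lintegral_mono' Measure.restrict_le_self le_rfl).trans ?_
    let I : ℝ → ENNReal := (Icc (-L / 2) (L / 2)).indicator (fun _ => 1)
    let H : ℝ → ENNReal :=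
      (Icc (Real.exp (-α)) (Real.exp α)).indicator (fun b => ENNReal.ofReal b⁻¹)
    have hI : Measurable I := measurable_const.indicator measurableSet_Icc
    have hH : Measurable H :=
      (ENNReal.measurable_ofReal.comp measurable_inv).indicator measurableSet_Icc
    have hint : ∫⁻ t, I t = ENNReal.ofReal L := by
      simp only [I]
      rw [lintegral_indicator measurableSet_Icc]
      simp
      ring_nf
    have hpt : ∀ y : ℝ × ℝ × ℝ,
        ((fun p : ℝ × ℝ × ℝ => ENNReal.ofReal (p.2.2 ^ 3)⁻¹) *
          fun y => ‖A y * (k1 (ginvMul y x) : ℂ)‖ₑ) y ≤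
        ENNReal.ofReal ((2 * α * L ^ 2)⁻¹ * K) * (I y.1 * (I y.2.1 * H y.2.2)) := by
      intro y
      by_cases hy : y ∈ Rset α L
      · have hb0 : 0 < y.2.2 := (Real.exp_pos _).trans_le hy.2.2.1
        have h1 : I y.1 = 1 := indicator_of_mem hy.1 _
        have h2 : I y.2.1 = 1 := indicator_of_mem hy.2.1 _
        have h3 : H y.2.2 = ENNReal.ofReal (y.2.2)⁻¹ := indicator_of_mem hy.2.2 _
        rw [h1, h2, h3, one_mul, one_mul, ← ENNReal.ofReal_mul (by positivity), Pi.mul_apply,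
          ← ofReal_norm, ← ENNReal.ofReal_mul (by positivity)]
        apply ENNReal.ofReal_le_ofReal
        have hk := kernel_bound α L hα hL x y hx hx' hN hy
        rw [norm_mul, Complex.norm_real, Real.norm_eq_abs]
        calc _ ≤ (y.2.2 ^ 3)⁻¹ * ((2 * α * L ^ 2)⁻¹ * (K * y.2.2 ^ 2)) := by
              gcongr
              exact hbd y
          _ = _ := by field_simp
      · simp [hsupp y hy]
    refine (lintegral_mono hpt).trans ?_
    rw [lintegral_const_mul _ (by fun_prop), Measure.volume_eq_prod,
      lintegral_prod_mul (g := fun z : ℝ × ℝ => I z.1 * H z.2) hI.aemeasurable (by fun_prop),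
      Measure.volume_eq_prod,
      lintegral_prod_mul hI.aemeasurable hH.aemeasurable, hint, lint_inv α hα,
      ← ENNReal.ofReal_mul (by positivity), ← ENNReal.ofReal_mul (by positivity),
      ← ENNReal.ofReal_mul (by positivity)]
    apply le_of_eq
    congr 1
    field_simp
  constructor
  · exact ⟨hmeas.aestronglyMeasurable, key.trans_lt ENNReal.ofReal_lt_top⟩
  · have h := (enorm_integral_le_lintegral_enorm _).trans key
    rw [← ofReal_norm] at h
    exact (ENNReal.ofReal_le_ofReal_iff hK0).1 h
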